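/- arXiv:1103.3510 — 3 statements merged into one kernel-verified Lean document; each statement's English description precedes it below -/
import Mathlib

section
/- Let X and Y be real normed spaces and T : X → Y a compact linear operator. Then on any interval (ε₁, ε₂) ⊂ ℝ with 0 < ε₁ < ε₂, the function ε ↦ 𝒩(ε) takes only finitely many values; equivalently, 𝒩(ε) has only finitely many discontinuities in (ε₁, ε₂). -/
/-- The number of degrees of freedom of a (compact) linear operator `T` at level `ε`:
the smallest `N : ℕ` (as an element of `ℕ∞`, with `⊤` if no such `N` exists) such that
there are vectors `ψ₁, …, ψ_N` in `Y` with
`inf_{a₁,…,a_N} ‖T x - ∑ aᵢ ψᵢ‖ ≤ ε` for every `x` in the closed unit ball of `X`. -/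
noncomputable def dof {X Y : Type*} [NormedAddCommGroup X] [NormedSpace ℝ X]
    [NormedAddCommGroup Y] [NormedSpace ℝ Y] (T : X →L[ℝ] Y) (ε : ℝ) : ℕ∞ :=
  sInf {N : ℕ∞ | ∃ (n : ℕ) (ψ : Fin n → Y), N = n ∧
    ∀ x : X, ‖x‖ ≤ 1 → (⨅ a : Fin n → ℝ, ‖T x - ∑ i, a i • ψ i‖) ≤ ε}

/-- On any interval `(ε₁, ε₂)` with `0 < ε₁ < ε₂`, the degrees-of-freedom function of a
compact operator takes only finitely many values. -/
theorem dof_finite_values_on_Ioo {X Y : Type*} [NormedAddCommGroup X] [NormedSpace ℝ X]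
    [NormedAddCommGroup Y] [NormedSpace ℝ Y] (T : X →L[ℝ] Y)
    (hT : IsCompactOperator T) (ε₁ ε₂ : ℝ) (hε₁ : 0 < ε₁) (h : ε₁ < ε₂) :
    (dof T '' Set.Ioo ε₁ ε₂).Finite := by
  obtain ⟨K, hK, hsub⟩ := IsCompactOperator.image_closedBall_subset_compact (f := (T : X →ₗ[ℝ] Y)) hT 1
  obtain ⟨t, ht, hcov⟩ := Metric.totallyBounded_iff.1 hK.totallyBounded ε₁ hε₁
  obtain ⟨n, ψ, hψ⟩ := ht.fin_param
  have hfin : (Set.Iic (n : ℕ∞)).Finite := by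
    refine ((Set.finite_Iic n).image (fun k : ℕ => (k : ℕ∞))).subset ?_
    intro m hm
    have hm' : m ≤ (n : ℕ∞) := hm
    lift m to ℕ using ne_top_of_le_ne_top (ENat.natCast_ne_top n) hm'
    exact ⟨m, by exact_mod_cast hm', rfl⟩
  refine hfin.subset ?_
  rintro _ ⟨ε, hε, rfl⟩
  show dof T ε ≤ (n : ℕ∞)
  unfold dof
  refine sInf_le ⟨n, ψ, rfl, fun x hx => ?_⟩
  have hx1 : T x ∈ K := hsub ⟨x, by simpa using hx, rfl⟩
  have hx2 := hcov hx1
  simp only [Set.mem_iUnion] at hx2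
  obtain ⟨y, hy, hxy⟩ := hx2
  rw [← hψ.2] at hy
  obtain ⟨j, rfl⟩ := hy
  refine (ciInf_le ⟨0, ?_⟩ (Pi.single j (1 : ℝ))).trans ?_
  · rintro _ ⟨a, rfl⟩
    exact norm_nonneg _
  · have hs : ∑ i, (Pi.single j (1 : ℝ) : Fin n → ℝ) i • ψ i = ψ j := by
      rw [Finset.sum_eq_single j] <;> simp +contextual
    rw [hs, ← dist_eq_norm]
    exact (Metric.mem_ball.1 hxy).le.trans hε.1.le
end

section
/- Let X and Y be real Banach spaces and T : X → Y a nonzero compact linear operator. Then for every n ≥ 0, the (n+1)-st Kolmogorov number of T equals the n-th jump point of the degrees-of-freedom function: d_{n+1}(T) = inf{ε > 0 : 𝒩(ε) ≤ n}. -/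
/-- The `n`-th Kolmogorov number of a bounded linear operator `T : X → Y`:
`d_n(T) = inf { ‖Q_S ∘ T‖ : S a linear subspace of Y, dim S < n }`, where
`‖Q_S ∘ T‖ = sup_{‖x‖ ≤ 1} inf_{y ∈ S} ‖T x - y‖` is the norm of `T` composed with
the natural quotient map `Q_S : Y → Y/S`. -/
noncomputable def kolmogorov {X Y : Type*} [NormedAddCommGroup X] [NormedSpace ℝ X]
    [NormedAddCommGroup Y] [NormedSpace ℝ Y] (n : ℕ) (T : X →L[ℝ] Y) : ℝ :=
  ⨅ S : {S : Submodule ℝ Y // Module.rank ℝ S < n},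
    ⨆ x ∈ Metric.closedBall (0 : X) 1, Metric.infDist (T x) (S.1 : Set Y)

section aux
variable {X Y : Type*} [NormedAddCommGroup X] [NormedSpace ℝ X]
    [NormedAddCommGroup Y] [NormedSpace ℝ Y]

lemma aux_span {n : ℕ} (ψ : Fin n → Y) (y : Y) :
    (⨅ a : Fin n → ℝ, ‖y - ∑ i, a i • ψ i‖) =
      Metric.infDist y (Submodule.span ℝ (Set.range ψ) : Set Y) := by
  rw [Metric.infDist_eq_iInf]
  have hs : Function.Surjective (fun a : Fin n → ℝ =>
      (⟨∑ i, a i • ψ i, (Submodule.mem_span_range_iff_exists_fun ℝ).2 ⟨a, rfl⟩⟩ :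
        (Submodule.span ℝ (Set.range ψ) : Set Y))) := by
    rintro ⟨z, hz⟩
    obtain ⟨a, ha⟩ := (Submodule.mem_span_range_iff_exists_fun ℝ).1 hz
    exact ⟨a, Subtype.ext ha⟩
  rw [← hs.iInf_comp]
  simp only [dist_eq_norm]

lemma aux_dof (T : X →L[ℝ] Y) (ε : ℝ) (n : ℕ) : dof T ε ≤ (n : ℕ∞) ↔
    ∃ S : Submodule ℝ Y, Module.rank ℝ S < ((n + 1 : ℕ) : Cardinal) ∧
      ∀ x : X, ‖x‖ ≤ 1 → Metric.infDist (T x) (S : Set Y) ≤ ε := by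
  unfold dof
  simp only [aux_span]
  constructor
  · intro h
    have hne : {N : ℕ∞ | ∃ (n : ℕ) (ψ : Fin n → Y), N = n ∧ ∀ x : X, ‖x‖ ≤ 1 →
        Metric.infDist (T x) (Submodule.span ℝ (Set.range ψ) : Set Y) ≤ ε}.Nonempty := by
      by_contra hc
      rw [Set.not_nonempty_iff_eq_empty] at hc
      rw [hc, sInf_empty] at h
      simp at h
    obtain ⟨m, ψ, hm, hx⟩ := csInf_mem hne
    rw [hm] at h
    have hmn : m ≤ n := by exact_mod_cast h
    refine ⟨_, ?_, hx⟩
    refine lt_of_le_of_lt (rank_span_le _) ?_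
    have := Cardinal.mk_range_le_lift (f := ψ)
    simp only [Cardinal.mk_fin, Cardinal.lift_natCast, Cardinal.lift_id'] at this
    have h3 : Cardinal.mk (Set.range ψ) ≤ (m : Cardinal) := by
      simpa using this
    refine lt_of_le_of_lt h3 ?_
    exact_mod_cast Nat.lt_succ_of_le hmn
  · rintro ⟨S, hS, hx⟩
    have hfin : Module.Finite ℝ S :=
      Module.rank_lt_aleph0_iff.1 (hS.trans Cardinal.natCast_lt_aleph0)
    have hr : Module.finrank ℝ S < n + 1 := by
      rw [← Module.finrank_eq_rank] at hS
      exact_mod_cast hS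
    let b := Module.finBasis ℝ S
    have hb : Submodule.span ℝ (Set.range (fun i => (b i : Y))) = S := by
      have : Set.range (fun i => (b i : Y)) = S.subtype '' Set.range b := by
        rw [← Set.range_comp]; rfl
      rw [this, Submodule.span_image, b.span_eq, Submodule.map_top, Submodule.range_subtype]
    have hle : ((Module.finrank ℝ S : ℕ) : ℕ∞) ≤ n := by
      exact_mod_cast Nat.lt_succ_iff.1 hr
    refine le_trans (sInf_le ?_) hle
    refine ⟨Module.finrank ℝ S, fun i => (b i : Y), rfl, ?_⟩
    rw [hb]; exact hx

lemma aux_infDist_le (T : X →L[ℝ] Y) (S : Submodule ℝ Y) (x : X) (hx : ‖x‖ ≤ 1) :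
    Metric.infDist (T x) (S : Set Y) ≤ ‖T‖ := by
  refine (Metric.infDist_le_dist_of_mem (S.zero_mem)).trans ?_
  rw [dist_zero_right]
  exact T.unit_le_opNorm x hx

lemma aux_sup_le (T : X →L[ℝ] Y) (S : Submodule ℝ Y) (ε : ℝ) (hε : 0 ≤ ε)
    (h : ∀ x : X, ‖x‖ ≤ 1 → Metric.infDist (T x) (S : Set Y) ≤ ε) :
    (⨆ x ∈ Metric.closedBall (0 : X) 1, Metric.infDist (T x) (S : Set Y)) ≤ ε :=
  Real.iSup_le (fun x => Real.iSup_le (fun hx => h x (by simpa using hx)) hε) hε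

lemma aux_le_sup (T : X →L[ℝ] Y) (S : Submodule ℝ Y) (x : X) (hx : ‖x‖ ≤ 1) :
    Metric.infDist (T x) (S : Set Y) ≤
    (⨆ x ∈ Metric.closedBall (0 : X) 1, Metric.infDist (T x) (S : Set Y)) := by
  have hx' : x ∈ Metric.closedBall (0 : X) 1 := by simpa using hx
  have hb : BddAbove (Set.range fun x : X =>
      ⨆ _ : x ∈ Metric.closedBall (0 : X) 1, Metric.infDist (T x) (S : Set Y)) := by
    refine ⟨‖T‖, ?_⟩
    rintro _ ⟨z, rfl⟩
    exact Real.iSup_le (fun hz => aux_infDist_le T S z (by simpa using hz)) (norm_nonneg _)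
  refine le_trans ?_ (le_ciSup hb x)
  rw [ciSup_pos hx']

lemma aux_sup_nonneg (T : X →L[ℝ] Y) (S : Submodule ℝ Y) :
    0 ≤ (⨆ x ∈ Metric.closedBall (0 : X) 1, Metric.infDist (T x) (S : Set Y)) :=
  Real.iSup_nonneg fun _ => Real.iSup_nonneg fun _ => Metric.infDist_nonneg

end aux

/-- For a nonzero compact operator between real Banach spaces, the `(n+1)`-st Kolmogorov
number equals the `n`-th jump point of the degrees-of-freedom function:
`d_(n+1)(T) = inf of the set of ε > 0 with 𝒩(ε) ≤ n`. -/
theorem kolmogorov_eq_jump_point {X Y : Type*} [NormedAddCommGroup X] [NormedSpace ℝ X]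
    [NormedAddCommGroup Y] [NormedSpace ℝ Y] [CompleteSpace X] [CompleteSpace Y]
    (T : X →L[ℝ] Y) (hT : IsCompactOperator T) (hT0 : T ≠ 0) (n : ℕ) :
    kolmogorov (n + 1) T = sInf {ε : ℝ | 0 < ε ∧ dof T ε ≤ (n : ℕ∞)} := by
  have hbot : Module.rank ℝ (⊥ : Submodule ℝ Y) < ((n + 1 : ℕ) : Cardinal) := by
    rw [rank_bot]; exact_mod_cast Nat.succ_pos n
  unfold kolmogorov
  have : Nonempty {S : Submodule ℝ Y // Module.rank ℝ S < ((n + 1 : ℕ) : Cardinal)} :=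
    ⟨⟨⊥, hbot⟩⟩
  apply le_antisymm
  · refine le_csInf ⟨‖T‖ + 1, by positivity, (aux_dof T _ n).2 ⟨⊥, hbot, fun x hx =>
      (aux_infDist_le T ⊥ x hx).trans (by linarith)⟩⟩ ?_
    rintro ε ⟨hε, hd⟩
    obtain ⟨S, hS, hx⟩ := (aux_dof T ε n).1 hd
    have hbd : BddBelow (Set.range fun S : {S : Submodule ℝ Y //
        Module.rank ℝ S < ((n + 1 : ℕ) : Cardinal)} =>
        ⨆ x ∈ Metric.closedBall (0 : X) 1, Metric.infDist (T x) (S.1 : Set Y)) := by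
      refine ⟨0, ?_⟩
      rintro _ ⟨S', rfl⟩
      exact aux_sup_nonneg T S'.1
    have h1 := ciInf_le hbd ⟨S, hS⟩
    exact h1.trans (aux_sup_le T S ε hε.le hx)
  · refine le_ciInf fun S => le_of_forall_pos_le_add fun δ hδ => ?_
    have h0 := aux_sup_nonneg T S.1
    refine csInf_le ⟨0, fun ε hε => hε.1.le⟩ ⟨by linarith, (aux_dof T _ n).2
      ⟨S.1, S.2, fun x hx => (aux_le_sup T S.1 x hx).trans (by linarith)⟩⟩
end

section
/- Let X and Y be real Banach spaces, T : X → Y a compact linear operator, and (S_m)_{m≥1} an increasing sequence of finite-dimensional linear subspaces of X (S_m ⊆ S_{m+1}) whose union is dense in X. Let T_m = T|_{S_m} : S_m → Y be the restriction of T to S_m. Then for every n ≥ 1, the Kolmogorov numbers of the restrictions converge to that of T: lim_{m→∞} d_n(T_m) = d_n(T). -/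
theorem kolm_bound {X Y : Type*} [NormedAddCommGroup X] [NormedSpace ℝ X]
    [NormedAddCommGroup Y] [NormedSpace ℝ Y] (T : X →L[ℝ] Y) (S : Submodule ℝ Y) (x : X) :
    (⨆ (_ : x ∈ Metric.closedBall (0 : X) 1), Metric.infDist (T x) (S : Set Y)) ≤ ‖T‖ := by
  refine Real.iSup_le (fun hx => ?_) (norm_nonneg _)
  have h1 := Metric.infDist_le_dist_of_mem (x := T x) (S.zero_mem : (0 : Y) ∈ (S : Set Y))
  rw [dist_zero_right] at h1
  exact h1.trans (T.unit_le_opNorm x (by simpa using hx))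

theorem kolm_le {X Z Y : Type*} [NormedAddCommGroup X] [NormedSpace ℝ X]
    [NormedAddCommGroup Z] [NormedSpace ℝ Z]
    [NormedAddCommGroup Y] [NormedSpace ℝ Y] (n : ℕ) (hn : 1 ≤ n) (T : X →L[ℝ] Y) (U : Z →L[ℝ] Y)
    (ε : ℝ) (hε : 0 ≤ ε)
    (h : ∀ x ∈ Metric.closedBall (0 : X) 1, ∃ z ∈ Metric.closedBall (0 : Z) 1,
      dist (T x) (U z) ≤ ε) : kolmogorov n T ≤ kolmogorov n U + ε := by
  have hne : Nonempty {S : Submodule ℝ Y // Module.rank ℝ S < n} :=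
    ⟨⟨⊥, by rw [rank_bot]; exact_mod_cast hn⟩⟩
  rw [← sub_le_iff_le_add]
  refine le_ciInf fun S => ?_
  rw [sub_le_iff_le_add]
  have hnn : 0 ≤ ⨆ z ∈ Metric.closedBall (0 : Z) 1, Metric.infDist (U z) (S.1 : Set Y) :=
    Real.iSup_nonneg fun _ => Real.iSup_nonneg fun _ => Metric.infDist_nonneg
  refine (ciInf_le ⟨0, ?_⟩ S).trans ?_
  · rintro _ ⟨S, rfl⟩
    exact Real.iSup_nonneg fun _ => Real.iSup_nonneg fun _ => Metric.infDist_nonneg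
  refine Real.iSup_le (fun x => Real.iSup_le (fun hx => ?_) (by linarith)) (by linarith)
  obtain ⟨z, hz, hd⟩ := h x hx
  have h1 := Metric.infDist_le_infDist_add_dist (s := (S.1 : Set Y)) (x := T x) (y := U z)
  have h2 := le_ciSup (f := fun z => ⨆ (_ : z ∈ Metric.closedBall (0 : Z) 1),
    Metric.infDist (U z) (S.1 : Set Y)) ⟨‖U‖, by rintro _ ⟨z, rfl⟩; exact kolm_bound U S.1 z⟩ z
  simp only [ciSup_pos hz] at h2
  linarith

/-- For a compact operator `T` between real Banach spaces and an increasing sequence of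
finite-dimensional subspaces `S m` of the domain with dense union, the Kolmogorov numbers
of the restrictions of `T` to `S m` converge to those of `T`. -/
theorem kolmogorov_restrict_tendsto {X Y : Type*} [NormedAddCommGroup X] [NormedSpace ℝ X]
    [NormedAddCommGroup Y] [NormedSpace ℝ Y] [CompleteSpace X] [CompleteSpace Y]
    (T : X →L[ℝ] Y) (hT : IsCompactOperator T) (S : ℕ → Submodule ℝ X)
    (hmono : Monotone S) (hfd : ∀ m, FiniteDimensional ℝ (S m))
    (hdense : Dense (⋃ m, (S m : Set X))) (n : ℕ) (hn : 1 ≤ n) :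
    Filter.Tendsto (fun m => kolmogorov n (T.comp (S m).subtypeL)) Filter.atTop
      (nhds (kolmogorov n T)) := by 
  have hup : ∀ m, kolmogorov n (T.comp (S m).subtypeL) ≤ kolmogorov n T := fun m => by
    have := kolm_le n hn (T.comp (S m).subtypeL) T 0 le_rfl
      (fun x hx => ⟨x, by simpa using hx, by simp⟩)
    simpa using this
  rw [Metric.tendsto_atTop]
  intro ε hε
  let A : ℕ → Set Y := fun m => T '' ((S m : Set X) ∩ Metric.closedBall 0 1)
  have hA : Monotone A := fun i j hij => Set.image_mono
    (Set.inter_subset_inter_left _ (hmono hij))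
  have hK : IsCompact (closure (T '' Metric.closedBall (0 : X) 1)) :=
    hT.isCompact_closure_image_closedBall (f := (T : X →ₗ[ℝ] Y)) 1
  have hcov : closure (T '' Metric.closedBall (0 : X) 1) ⊆
      ⋃ m, Metric.thickening (ε / 2) (A m) := by
    have h1 : Metric.closedBall (0 : X) 1 ⊆
        closure (Metric.ball (0 : X) 1 ∩ ⋃ m, (S m : Set X)) := by
      rw [← closure_ball (0 : X) one_ne_zero]
      exact closure_minimal (hdense.open_subset_closure_inter Metric.isOpen_ball) isClosed_closure
    have h2 : closure (T '' Metric.closedBall (0 : X) 1) ⊆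
        closure (T '' (Metric.ball (0 : X) 1 ∩ ⋃ m, (S m : Set X))) :=
      closure_minimal ((Set.image_mono h1).trans (image_closure_subset_closure_image T.continuous))
        isClosed_closure
    intro y hy
    obtain ⟨_, ⟨x, ⟨hxb, hxS⟩, rfl⟩, hd⟩ := Metric.mem_closure_iff.1 (h2 hy) (ε / 2) (by linarith)
    obtain ⟨m, hm⟩ := Set.mem_iUnion.1 hxS
    exact Set.mem_iUnion.2 ⟨m, Metric.mem_thickening_iff.2
      ⟨T x, ⟨x, ⟨hm, Metric.ball_subset_closedBall hxb⟩, rfl⟩, hd⟩⟩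
  obtain ⟨N, hN⟩ := hK.elim_directed_cover _ (fun m => Metric.isOpen_thickening) hcov
    (Monotone.directed_le fun i j hij => Metric.thickening_subset_of_subset _ (hA hij))
  refine ⟨N, fun m hm => ?_⟩
  have hlow : kolmogorov n T ≤ kolmogorov n (T.comp (S m).subtypeL) + ε / 2 := by
    refine kolm_le n hn _ _ _ (by linarith) fun x hx => ?_
    have := Metric.thickening_subset_of_subset (ε / 2) (hA hm)
      (hN (subset_closure ⟨x, hx, rfl⟩))
    obtain ⟨_, ⟨z, ⟨hzS, hz⟩, rfl⟩, hd⟩ := Metric.mem_thickening_iff.1 this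
    exact ⟨⟨z, hzS⟩, by simpa using hz, hd.le⟩
  rw [Real.dist_eq, abs_lt]
  have := hup m
  constructor <;> linarith
end
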